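/- With the Ornstein–Uhlenbeck expected signal h(t) = ι e^{-γt}, the exponential decay kernel G(t) = κρ e^{-ρt} and zero risk aversion φ = 0, the measure μ* = A·δ₀ + (B e^{-γt} + C)·1_{[0,T]}(t) dt + D·δ_T belongs to Ξ(x) and is the unique minimizer of the cost functional C over Ξ(x); its inventory satisfies X^{μ*}_t = x + A + (B/γ)(1 - e^{-γt}) + C t for t ∈ (0,T] and X^{μ*}_t = 0 for t > T. -/

import Mathlib

open MeasureTheory

/-- Integral of a real function against a finite signed Borel measure,
via its Jordan decomposition. -/
noncomputable def sint (ν : SignedMeasure ℝ) (f : ℝ → ℝ) : ℝ :=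
  (∫ t, f t ∂ν.toJordanDecomposition.posPart) -
    ∫ t, f t ∂ν.toJordanDecomposition.negPart

/-- The set Ξ(x) of deterministic admissible strategies: finite signed Borel
measures supported in `[0,T]` with total mass `-x`. -/
def Xi (T x : ℝ) : Set (SignedMeasure ℝ) :=
  {μ | (∀ s : Set ℝ, s ∩ Set.Icc 0 T = ∅ → μ s = 0) ∧ μ Set.univ = -x}


def BM (f : ℝ → ℝ) : Prop := Measurable f ∧ ∃ c, ∀ x, ‖f x‖ ≤ c

lemma BM.integrable {f : ℝ → ℝ} (hf : BM f) (P : Measure ℝ) [IsFiniteMeasure P] :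
    Integrable f P := by
  obtain ⟨hm, c, hc⟩ := hf
  exact Integrable.of_bound hm.aestronglyMeasurable c (Filter.Eventually.of_forall hc)

lemma BM.mul {f g : ℝ → ℝ} (hf : BM f) (hg : BM g) : BM (fun t => f t * g t) := by
  obtain ⟨hm, c, hc⟩ := hf
  obtain ⟨hm', c', hc'⟩ := hg
  refine ⟨hm.mul hm', c * c', fun x => ?_⟩
  rw [norm_mul]
  exact mul_le_mul (hc x) (hc' x) (norm_nonneg _) ((norm_nonneg _).trans (hc x))

lemma BM.add {f g : ℝ → ℝ} (hf : BM f) (hg : BM g) : BM (fun t => f t + g t) := by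
  obtain ⟨hm, c, hc⟩ := hf
  obtain ⟨hm', c', hc'⟩ := hg
  exact ⟨hm.add hm', c + c', fun x => (norm_add_le _ _).trans (add_le_add (hc x) (hc' x))⟩

lemma BM.const (a : ℝ) : BM (fun _ => a) := ⟨measurable_const, ‖a‖, fun _ => le_rfl⟩

lemma jordan_eq (ν : SignedMeasure ℝ) :
    ν = ν.toJordanDecomposition.posPart.toSignedMeasure
      - ν.toJordanDecomposition.negPart.toSignedMeasure :=
  ν.toSignedMeasure_toJordanDecomposition.symm

lemma sint_of_eq {ν : SignedMeasure ℝ} {P N : Measure ℝ} [IsFiniteMeasure P] [IsFiniteMeasure N]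
    (h : ν = P.toSignedMeasure - N.toSignedMeasure) {f : ℝ → ℝ} (hf : BM f) :
    sint ν f = (∫ t, f t ∂P) - ∫ t, f t ∂N := by
  have h1 := jordan_eq ν
  rw [h] at h1
  rw [← h] at h1
  set p := ν.toJordanDecomposition.posPart with hp
  set n := ν.toJordanDecomposition.negPart with hn
  have h2 : (P + n).toSignedMeasure = (p + N).toSignedMeasure := by
    rw [Measure.toSignedMeasure_add, Measure.toSignedMeasure_add]
    have h3 := h.symm.trans h1
    rw [sub_eq_sub_iff_add_eq_add] at h3
    exact h3
  have h4 := Measure.toSignedMeasure_eq_toSignedMeasure_iff.1 h2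
  have h5 : ∫ t, f t ∂(P + n) = ∫ t, f t ∂(p + N) := by rw [h4]
  rw [integral_add_measure (hf.integrable _) (hf.integrable _),
    integral_add_measure (hf.integrable _) (hf.integrable _)] at h5
  simp only [sint]
  rw [← hp, ← hn]
  linarith

lemma sint_sub (μ ν : SignedMeasure ℝ) {f : ℝ → ℝ} (hf : BM f) :
    sint (μ - ν) f = sint μ f - sint ν f := by
  have : μ - ν = (μ.toJordanDecomposition.posPart + ν.toJordanDecomposition.negPart).toSignedMeasure
      - (μ.toJordanDecomposition.negPart + ν.toJordanDecomposition.posPart).toSignedMeasure := by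
    conv_lhs => rw [jordan_eq μ, jordan_eq ν]
    rw [Measure.toSignedMeasure_add, Measure.toSignedMeasure_add]
    abel
  rw [sint_of_eq this hf, integral_add_measure (hf.integrable _) (hf.integrable _),
    integral_add_measure (hf.integrable _) (hf.integrable _)]
  simp only [sint]
  ring

lemma sint_add (ν : SignedMeasure ℝ) {f g : ℝ → ℝ} (hf : BM f) (hg : BM g) :
    sint ν (fun t => f t + g t) = sint ν f + sint ν g := by
  simp only [sint]
  rw [integral_add (hf.integrable _) (hg.integrable _),
    integral_add (hf.integrable _) (hg.integrable _)]
  ring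

lemma sint_const_mul (ν : SignedMeasure ℝ) (a : ℝ) (f : ℝ → ℝ) :
    sint ν (fun t => a * f t) = a * sint ν f := by
  simp only [sint, integral_const_mul]
  ring

lemma sint_one (ν : SignedMeasure ℝ) : sint ν (fun _ => 1) = ν Set.univ := by
  conv_rhs => rw [jordan_eq ν]
  simp only [sint, integral_const, sub_apply]
  rw [Measure.toSignedMeasure_apply_measurable MeasurableSet.univ,
    Measure.toSignedMeasure_apply_measurable MeasurableSet.univ]
  simp

def Supp (T : ℝ) (ν : SignedMeasure ℝ) : Prop := ∀ s : Set ℝ, s ∩ Set.Icc 0 T = ∅ → ν s = 0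

lemma Supp.sub {T : ℝ} {μ ν : SignedMeasure ℝ} (h : Supp T μ) (h' : Supp T ν) :
    Supp T (μ - ν) := fun s hs => by
  rw [sub_apply, h s hs, h' s hs, sub_zero]

lemma Supp.ae {T : ℝ} {ν : SignedMeasure ℝ} (h : Supp T ν) :
    (∀ᵐ t ∂ν.toJordanDecomposition.posPart, t ∈ Set.Icc 0 T) ∧
    (∀ᵐ t ∂ν.toJordanDecomposition.negPart, t ∈ Set.Icc 0 T) := by
  obtain ⟨i, hi, h1, h2, hp, hn⟩ := ν.toJordanDecomposition_spec
  have hm : MeasurableSet (Set.Icc (0:ℝ) T)ᶜ := measurableSet_Icc.compl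
  constructor
  · rw [ae_iff, hp]
    change (ν.toMeasureOfZeroLE i hi h1) (Set.Icc (0:ℝ) T)ᶜ = 0
    rw [SignedMeasure.toMeasureOfZeroLE_apply _ _ _ hm, ENNReal.coe_eq_zero]
    apply NNReal.eq
    change ν _ = 0
    apply h
    ext x; simp
  · rw [ae_iff, hn]
    change (ν.toMeasureOfLEZero iᶜ hi.compl h2) (Set.Icc (0:ℝ) T)ᶜ = 0
    rw [SignedMeasure.toMeasureOfLEZero_apply _ _ _ hm, ENNReal.coe_eq_zero]
    apply NNReal.eq
    change - ν _ = 0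
    rw [h, neg_zero]
    ext x; simp

lemma sint_congr {T : ℝ} {ν : SignedMeasure ℝ} (h : Supp T ν) {f g : ℝ → ℝ}
    (hfg : ∀ t ∈ Set.Icc 0 T, f t = g t) : sint ν f = sint ν g := by
  obtain ⟨hp, hn⟩ := h.ae
  simp only [sint]
  congr 1
  · exact integral_congr_ae (hp.mono hfg)
  · exact integral_congr_ae (hn.mono hfg)

lemma sint_meas (ν : SignedMeasure ℝ) {g : ℝ → ℝ → ℝ} (hg : Measurable (Function.uncurry g))
    {c : ℝ} (hc : ∀ u t, ‖g u t‖ ≤ c) : BM (fun u => sint ν (g u)) := by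
  refine ⟨?_, c * ν.toJordanDecomposition.posPart.real Set.univ +
    c * ν.toJordanDecomposition.negPart.real Set.univ, fun u => ?_⟩
  · exact (hg.stronglyMeasurable.integral_prod_right.measurable).sub
      (hg.stronglyMeasurable.integral_prod_right.measurable)
  · refine (norm_sub_le _ _).trans (add_le_add ?_ ?_)
    · exact norm_integral_le_of_norm_le_const (Filter.Eventually.of_forall (hc u))
    · exact norm_integral_le_of_norm_le_const (Filter.Eventually.of_forall (hc u))

lemma sint_swap (ν : SignedMeasure ℝ) (l : Measure ℝ) [IsFiniteMeasure l] {g : ℝ → ℝ → ℝ}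
    (hg : Measurable (Function.uncurry g)) {c : ℝ} (hc : ∀ u t, ‖g u t‖ ≤ c) :
    sint ν (fun t => ∫ u, g u t ∂l) = ∫ u, sint ν (g u) ∂l := by
  have key : ∀ P : Measure ℝ, IsFiniteMeasure P →
      Integrable (Function.uncurry g) (l.prod P) := fun P _ =>
    Integrable.of_bound hg.aestronglyMeasurable c (Filter.Eventually.of_forall fun p => hc p.1 p.2)
  have i1 := key ν.toJordanDecomposition.posPart inferInstance
  have i2 := key ν.toJordanDecomposition.negPart inferInstance
  simp only [sint]
  have h3 := integral_sub i1.integral_prod_left i2.integral_prod_left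
  simp only [Function.uncurry_apply_pair] at h3
  rw [h3, integral_integral_swap i1, integral_integral_swap i2]

noncomputable def ph (ρ : ℝ) (u t : ℝ) : ℝ :=
  if u ≤ t then Real.exp (-ρ * |t|) else 0

lemma ph_meas (ρ : ℝ) : Measurable (Function.uncurry (ph ρ)) := by
  unfold ph Function.uncurry
  refine Measurable.ite (measurableSet_le measurable_fst measurable_snd) ?_ measurable_const
  fun_prop

lemma ph_bd {ρ : ℝ} (hρ : 0 < ρ) (u t : ℝ) : ‖ph ρ u t‖ ≤ 1 := by
  unfold ph
  split_ifs
  · rw [Real.norm_eq_abs, Real.abs_exp, Real.exp_le_one_iff]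
    nlinarith [abs_nonneg t]
  · simp

lemma ph_BM {ρ : ℝ} (hρ : 0 < ρ) (u : ℝ) : BM (ph ρ u) :=
  ⟨(ph_meas ρ).comp measurable_prodMk_left, 1, ph_bd hρ u⟩

noncomputable def lam (ρ T : ℝ) : Measure ℝ :=
  (volume.restrict (Set.Iic T)).withDensity (fun u => ENNReal.ofReal (2 * ρ * Real.exp (2 * ρ * u)))

lemma lam_fin {ρ : ℝ} (hρ : 0 < ρ) (T : ℝ) : IsFiniteMeasure (lam ρ T) := by
  apply isFiniteMeasure_withDensity_ofReal
  have : IntegrableOn (fun u => 2 * ρ * Real.exp (2 * ρ * u)) (Set.Iic T) :=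
    (integrableOn_exp_mul_Iic (by positivity) T).const_mul _
  exact this.2

lemma lam_integral {ρ : ℝ} (hρ : 0 < ρ) (T : ℝ) (f : ℝ → ℝ) :
    ∫ u, f u ∂(lam ρ T) = ∫ u in Set.Iic T, 2 * ρ * Real.exp (2 * ρ * u) * f u := by
  unfold lam
  rw [integral_withDensity_eq_integral_toReal_smul (by fun_prop) (by simp)]
  refine integral_congr_ae (Filter.Eventually.of_forall fun u => ?_)
  simp only [smul_eq_mul]
  rw [ENNReal.toReal_ofReal (by positivity)]

lemma lam_kernel {ρ T : ℝ} (hρ : 0 < ρ) {t s : ℝ} (ht : t ∈ Set.Icc 0 T) (hs : s ∈ Set.Icc 0 T) :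
    ∫ u, ph ρ u t * ph ρ u s ∂(lam ρ T) = Real.exp (-ρ * |t - s|) := by
  rw [lam_integral hρ]
  have e : ∀ u, 2 * ρ * Real.exp (2 * ρ * u) * (ph ρ u t * ph ρ u s) =
      (Set.Iic (min t s)).indicator (fun u => 2 * ρ * Real.exp (-ρ * t) * Real.exp (-ρ * s)
        * Real.exp (2 * ρ * u)) u := by
    intro u
    unfold ph
    rw [abs_of_nonneg ht.1, abs_of_nonneg hs.1]
    by_cases h1 : u ≤ t <;> by_cases h2 : u ≤ s <;> simp [h1, h2]
    ring
  simp_rw [e]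
  rw [setIntegral_indicator measurableSet_Iic, Set.Iic_inter_Iic,
    min_eq_right ((min_le_left _ _).trans ht.2), integral_const_mul,
    integral_exp_mul_Iic (by positivity)]
  have : 2 * ρ * Real.exp (-ρ * t) * Real.exp (-ρ * s) * (Real.exp (2 * ρ * min t s) / (2 * ρ))
      = Real.exp (-ρ * t) * Real.exp (-ρ * s) * Real.exp (2 * ρ * min t s) := by
    field_simp
  rw [this, ← Real.exp_add, ← Real.exp_add]
  congr 1
  rcases le_total t s with h | h
  · rw [min_eq_left h, abs_of_nonpos (by linarith)]; ring
  · rw [min_eq_right h, abs_of_nonneg (by linarith)]; ring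

lemma quad {κ ρ T : ℝ} (hρ : 0 < ρ) {μ ν : SignedMeasure ℝ} (hμ : Supp T μ) (hν : Supp T ν) :
    sint μ (fun t => sint ν (fun s => κ * ρ * Real.exp (-ρ * |t - s|))) =
      κ * ρ * ∫ u, sint μ (ph ρ u) * sint ν (ph ρ u) ∂(lam ρ T) := by
  have := lam_fin hρ T
  have b := sint_meas ν (ph_meas ρ) (ph_bd hρ)
  have h1 : ∀ t ∈ Set.Icc 0 T, sint ν (fun s => κ * ρ * Real.exp (-ρ * |t - s|)) =
      κ * ρ * ∫ u, ph ρ u t * sint ν (ph ρ u) ∂(lam ρ T) := by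
    intro t ht
    rw [sint_const_mul]
    congr 1
    rw [sint_congr hν (fun s hs => (lam_kernel hρ ht hs).symm)]
    rw [sint_swap ν (lam ρ T) (g := fun u s => ph ρ u t * ph ρ u s) (c := 1)]
    · simp_rw [sint_const_mul]
    · have h := ph_meas ρ
      exact (h.comp (measurable_fst.prodMk measurable_const)).mul h
    · intro u s
      rw [norm_mul]
      exact mul_le_one₀ (ph_bd hρ _ _) (norm_nonneg _) (ph_bd hρ _ _)
  rw [sint_congr hμ h1, sint_const_mul]
  congr 1
  obtain ⟨bm, c, hc⟩ := b
  rw [sint_swap μ (lam ρ T) (g := fun u t => ph ρ u t * sint ν (ph ρ u)) (c := c)]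
  · refine integral_congr_ae (Filter.Eventually.of_forall fun u => ?_)
    simp only
    rw [mul_comm, ← sint_const_mul]
    congr 1; ext t; ring
  · exact (ph_meas ρ).mul (bm.comp measurable_fst)
  · intro u s
    rw [norm_mul]
    have := mul_le_mul (ph_bd hρ u s) (hc u) (norm_nonneg _) zero_le_one
    simpa using this

lemma ph_left_tendsto (ρ : ℝ) {w : ℕ → ℝ} {u : ℝ} (hw : ∀ n, w n < u)
    (hlim : Filter.Tendsto w Filter.atTop (nhds u)) (t : ℝ) :
    Filter.Tendsto (fun n => ph ρ (w n) t) Filter.atTop (nhds (ph ρ u t)) := by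
  refine tendsto_const_nhds.congr' ?_
  by_cases h : u ≤ t
  · refine Filter.Eventually.of_forall fun n => ?_
    simp [ph, h, (hw n).le.trans h]
  · push Not at h
    filter_upwards [hlim.eventually_const_lt h] with n hn
    simp [ph, not_le.2 h, not_le.2 hn]

lemma posdef {ρ T : ℝ} (hρ : 0 < ρ) {ν : SignedMeasure ℝ} (hν : Supp T ν)
    (h0 : ∫ u, sint ν (ph ρ u) * sint ν (ph ρ u) ∂(lam ρ T) ≤ 0) : ν = 0 := by
  have := lam_fin hρ T
  have b := sint_meas ν (ph_meas ρ) (ph_bd hρ)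
  have hz : (fun u => sint ν (ph ρ u) * sint ν (ph ρ u)) =ᵐ[lam ρ T] 0 := by
    rw [← integral_eq_zero_iff_of_nonneg (fun u => mul_self_nonneg _) ((b.mul b).integrable _)]
    exact le_antisymm h0 (integral_nonneg fun u => mul_self_nonneg _)
  have hz2 : ∀ᵐ u, sint ν (ph ρ u) = 0 := by
    unfold lam at hz
    rw [Filter.EventuallyEq, ae_withDensity_iff (by fun_prop),
      ae_restrict_iff' measurableSet_Iic] at hz
    filter_upwards [hz] with u hu
    by_cases hT : u ≤ T
    · have := hu hT (by simpa using by positivity)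
      simpa using this
    · rw [sint_congr hν (g := fun _ => 0)]
      · simp [sint]
      · intro t ht
        unfold ph
        rw [if_neg]
        exact fun h => hT (h.trans ht.2)
  have hall : ∀ u, sint ν (ph ρ u) = 0 := by
    intro u
    obtain ⟨w, -, hw, hlim⟩ := (Measure.dense_of_ae hz2).exists_seq_strictMono_tendsto u
    have key : ∀ P : Measure ℝ, IsFiniteMeasure P →
        Filter.Tendsto (fun n => ∫ t, ph ρ (w n) t ∂P) Filter.atTop (nhds (∫ t, ph ρ u t ∂P)) :=
      fun P _ => tendsto_integral_of_dominated_convergence (fun _ => 1)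
        (fun n => (ph_BM hρ _).1.aestronglyMeasurable) (integrable_const _)
        (fun n => Filter.Eventually.of_forall (ph_bd hρ _))
        (Filter.Eventually.of_forall (ph_left_tendsto ρ (fun n => (hw n).1) hlim))
    have l1 := (key ν.toJordanDecomposition.posPart inferInstance).sub
      (key ν.toJordanDecomposition.negPart inferInstance)
    have l2 : ∀ n, (∫ t, ph ρ (w n) t ∂ν.toJordanDecomposition.posPart) -
        (∫ t, ph ρ (w n) t ∂ν.toJordanDecomposition.negPart) = 0 := fun n => (hw n).2
    simp_rw [l2] at l1
    exact tendsto_nhds_unique l1 tendsto_const_nhds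
  let e : ℝ → ENNReal := fun t => ENNReal.ofReal (Real.exp (-ρ * |t|))
  have em : Measurable e := by fun_prop
  have hwd : ∀ P : Measure ℝ, IsFiniteMeasure P → ∀ u,
      (P.withDensity e) (Set.Ici u) = ENNReal.ofReal (∫ t, ph ρ u t ∂P) := by
    intro P _ u
    rw [withDensity_apply _ measurableSet_Ici,
      ofReal_integral_eq_lintegral_ofReal ((ph_BM hρ u).integrable _),
      ← lintegral_indicator measurableSet_Ici]
    · refine lintegral_congr fun t => ?_
      by_cases h : u ≤ t <;> simp [ph, h, e]
    · refine Filter.Eventually.of_forall fun t => ?_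
      unfold ph; simp only [Pi.zero_apply]; split_ifs <;> positivity
  have hfin : IsFiniteMeasure (ν.toJordanDecomposition.posPart.withDensity e) := by
    apply isFiniteMeasure_withDensity_ofReal
    refine (Integrable.of_bound (by fun_prop) 1 (Filter.Eventually.of_forall fun t => ?_)).2
    rw [Real.norm_eq_abs, Real.abs_exp, Real.exp_le_one_iff]
    nlinarith [abs_nonneg t]
  have hm : ν.toJordanDecomposition.posPart.withDensity e =
      ν.toJordanDecomposition.negPart.withDensity e := by
    apply Measure.ext_of_Ici
    intro u
    rw [hwd _ inferInstance, hwd _ inferInstance]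
    congr 1
    exact sub_eq_zero.1 (hall u)
  have hpn : ν.toJordanDecomposition.posPart = ν.toJordanDecomposition.negPart := by
    have h1 : ∀ P : Measure ℝ, (P.withDensity e).withDensity (fun x => (e x)⁻¹) = P := fun P =>
      withDensity_inv_same em (Filter.Eventually.of_forall fun t => by simp [e, Real.exp_pos])
        (Filter.Eventually.of_forall fun t => by simp [e])
    rw [← h1 ν.toJordanDecomposition.posPart, hm, h1]
  rw [jordan_eq ν]
  simp_rw [hpn]
  simp

noncomputable def half (T A D : ℝ) (g : ℝ → ℝ) : Measure ℝ :=
  ENNReal.ofReal A • Measure.dirac 0 +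
    (volume.restrict (Set.Icc 0 T)).withDensity (fun t => ENNReal.ofReal (g t)) +
    ENNReal.ofReal D • Measure.dirac T

lemma wd_fin {T : ℝ} {g : ℝ → ℝ} (hg : Continuous g) :
    IsFiniteMeasure ((volume.restrict (Set.Icc 0 T)).withDensity (fun t => ENNReal.ofReal (g t))) :=
  isFiniteMeasure_withDensity_ofReal (hg.continuousOn.integrableOn_compact isCompact_Icc).2

lemma half_fin {T A D : ℝ} {g : ℝ → ℝ} (hg : Continuous g) : IsFiniteMeasure (half T A D g) := by
  have := wd_fin (T := T) hg
  have h1 : IsFiniteMeasure (ENNReal.ofReal A • Measure.dirac (0:ℝ)) :=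
    Measure.smul_finite _ ENNReal.ofReal_ne_top
  have h2 : IsFiniteMeasure (ENNReal.ofReal D • Measure.dirac T) :=
    Measure.smul_finite _ ENNReal.ofReal_ne_top
  unfold half
  infer_instance

lemma half_integral {T A D : ℝ} {g : ℝ → ℝ} (hg : Continuous g) {f : ℝ → ℝ} (hf : BM f) :
    ∫ t, f t ∂(half T A D g) = max A 0 * f 0 + (∫ t in Set.Icc 0 T, max (g t) 0 * f t)
      + max D 0 * f T := by
  have := wd_fin (T := T) hg
  have h1 : IsFiniteMeasure (ENNReal.ofReal A • Measure.dirac (0:ℝ)) :=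
    Measure.smul_finite _ ENNReal.ofReal_ne_top
  have h2 : IsFiniteMeasure (ENNReal.ofReal D • Measure.dirac T) :=
    Measure.smul_finite _ ENNReal.ofReal_ne_top
  unfold half
  rw [integral_add_measure (hf.integrable _) (hf.integrable _),
    integral_add_measure (hf.integrable _) (hf.integrable _),
    integral_smul_measure, integral_smul_measure, integral_dirac, integral_dirac,
    integral_withDensity_eq_integral_toReal_smul (by fun_prop) (by simp)]
  simp [ENNReal.toReal_ofReal']

lemma half_diff {T A D : ℝ} {g : ℝ → ℝ} (hg : Continuous g) {f : ℝ → ℝ} (hf : BM f) :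
    (∫ t, f t ∂(half T A D g)) - ∫ t, f t ∂(half T (-A) (-D) (fun t => - g t)) =
      A * f 0 + (∫ t in Set.Icc 0 T, g t * f t) + D * f T := by
  rw [half_integral hg hf, half_integral (g := fun t => - g t) (by fun_prop) hf]
  have e : ∀ a : ℝ, max a 0 - max (-a) 0 = a := fun a => by
    rcases le_total a 0 with h | h
    · rw [max_eq_right h, max_eq_left (by linarith)]; ring
    · rw [max_eq_left h, max_eq_right (by linarith)]; ring
  have ii : ∀ q : ℝ → ℝ, Continuous q → IntegrableOn (fun t => q t * f t) (Set.Icc 0 T) := by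
    intro q hq
    obtain ⟨hm, c, hc⟩ := hf
    exact (hq.continuousOn.integrableOn_compact isCompact_Icc).mul_bdd (c := c)
      hm.aestronglyMeasurable (Filter.Eventually.of_forall hc)
  have e2 : (∫ t in Set.Icc 0 T, g t * f t) = (∫ t in Set.Icc 0 T, max (g t) 0 * f t) -
      ∫ t in Set.Icc 0 T, max (-g t) 0 * f t := by
    rw [← integral_sub (ii _ (by fun_prop)) (ii _ (by fun_prop))]
    refine integral_congr_ae (Filter.Eventually.of_forall fun t => ?_)
    simp only
    rw [← sub_mul, e]
  rw [e2]
  have := e A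
  have := e D
  linear_combination (f 0) * e A + (f T) * e D

lemma star_sint {T A D : ℝ} {g : ℝ → ℝ} (hg : Continuous g) {μ : SignedMeasure ℝ}
    (hμ : ∀ s : Set ℝ, MeasurableSet s → μ s =
      s.indicator (fun _ => A) (0:ℝ) + (∫ t in s ∩ Set.Icc 0 T, g t)
        + s.indicator (fun _ => D) T) {f : ℝ → ℝ} (hf : BM f) :
    sint μ f = A * f 0 + (∫ t in Set.Icc 0 T, g t * f t) + D * f T := by
  have := half_fin (T := T) (A := A) (D := D) hg
  have := half_fin (T := T) (A := -A) (D := -D) (g := fun t => - g t) (by fun_prop)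
  rw [← half_diff hg hf]
  refine sint_of_eq ?_ hf
  ext s hs
  rw [hμ s hs, sub_apply, Measure.toSignedMeasure_apply_measurable hs,
    Measure.toSignedMeasure_apply_measurable hs]
  have bi : BM (s.indicator fun _ => (1:ℝ)) := by
    refine ⟨measurable_const.indicator hs, 1, fun t => ?_⟩
    by_cases h : t ∈ s <;> simp [h]
  have h := half_diff (T := T) (A := A) (D := D) hg bi
  rw [integral_indicator_const _ hs, integral_indicator_const _ hs, smul_eq_mul, smul_eq_mul,
    mul_one, mul_one] at h
  rw [h]
  have e3 : (∫ t in s ∩ Set.Icc 0 T, g t) =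
      ∫ t in Set.Icc 0 T, g t * s.indicator (fun _ => (1:ℝ)) t := by
    rw [Set.inter_comm, ← setIntegral_indicator hs]
    refine integral_congr_ae (Filter.Eventually.of_forall fun t => ?_)
    by_cases h : t ∈ s <;> simp [h]
  rw [e3]
  congr 1
  · congr 1
    by_cases h : (0:ℝ) ∈ s <;> simp [h]
  · by_cases h : T ∈ s <;> simp [h]

lemma gint {B C γ : ℝ} (hγ : 0 < γ) {a : ℝ} (ha : 0 ≤ a) :
    ∫ t in Set.Icc 0 a, (B * Real.exp (-γ * t) + C) =
      (B / γ) * (1 - Real.exp (-γ * a)) + C * a := by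
  rw [integral_Icc_eq_integral_Ioc, ← intervalIntegral.integral_of_le ha,
    intervalIntegral.integral_eq_sub_of_hasDerivAt
      (f := fun t => -(B / γ) * Real.exp (-γ * t) + C * t)]
  · simp; ring
  · intro t _
    have h1 := (((hasDerivAt_id t).const_mul (-γ)).exp.const_mul (-(B/γ))).add
      ((hasDerivAt_id t).const_mul C)
    refine HasDerivAt.congr_deriv h1 ?_
    simp only [id]; field_simp
  · exact (by fun_prop : Continuous _).intervalIntegrable _ _

lemma foc {T k γ ρ A B C D t : ℝ} (hρ : 0 < ρ)
    (hB : B = k * (ρ^2 - γ^2))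
    (hC : C = ρ * A - k * ρ * (ρ + γ))
    (hD : D = A - k * ((ρ + γ) - (ρ - γ) * Real.exp (-γ * T)))
    (ht : t ∈ Set.Icc 0 T) :
    A * Real.exp (-ρ * |t - 0|) +
      (∫ s in Set.Icc 0 T, (B * Real.exp (-γ * s) + C) * Real.exp (-ρ * |t - s|)) +
      D * Real.exp (-ρ * |t - T|) = 2 * k * ρ * Real.exp (-γ * t) + 2 * C / ρ := by
  obtain ⟨h0, hT⟩ := ht
  have hc : Continuous fun s => (B * Real.exp (-γ * s) + C) * Real.exp (-ρ * |t - s|) := by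
    fun_prop
  rw [integral_Icc_eq_integral_Ioc, ← intervalIntegral.integral_of_le (h0.trans hT),
    ← intervalIntegral.integral_add_adjacent_intervals (hc.intervalIntegrable 0 t)
      (hc.intervalIntegrable t T)]
  have i1 : ∫ s in (0:ℝ)..t, (B * Real.exp (-γ * s) + C) * Real.exp (-ρ * |t - s|) =
      ∫ s in (0:ℝ)..t, (B * Real.exp (-γ * s) + C) * Real.exp (ρ * (s - t)) := by
    refine intervalIntegral.integral_congr fun s hs => ?_
    rw [Set.uIcc_of_le h0] at hs
    rw [abs_of_nonneg (by linarith [hs.2])]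
    congr 2; ring
  have i2 : ∫ s in t..T, (B * Real.exp (-γ * s) + C) * Real.exp (-ρ * |t - s|) =
      ∫ s in t..T, (B * Real.exp (-γ * s) + C) * Real.exp (-ρ * (s - t)) := by
    refine intervalIntegral.integral_congr fun s hs => ?_
    rw [Set.uIcc_of_le hT] at hs
    rw [abs_of_nonpos (by linarith [hs.1])]
    congr 2; ring
  have d : ∀ a c s : ℝ, HasDerivAt (fun s => Real.exp (a * (s - c))) (a * Real.exp (a * (s - c))) s := by
    intro a c s
    have := (((hasDerivAt_id s).sub_const c).const_mul a).exp
    refine HasDerivAt.congr_deriv this ?_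
    simp only [id]; ring
  have d0 : ∀ s : ℝ, HasDerivAt (fun s => Real.exp (-γ * s)) (-γ * Real.exp (-γ * s)) s := by
    intro s; simpa using d (-γ) 0 s
  rw [i1, i2, intervalIntegral.integral_eq_sub_of_hasDerivAt (a := 0) (b := t)
      (f := fun s => k * (ρ + γ) * (Real.exp (-γ * s) * Real.exp (ρ * (s - t))) +
        C / ρ * Real.exp (ρ * (s - t))),
    intervalIntegral.integral_eq_sub_of_hasDerivAt (a := t) (b := T)
      (f := fun s => -k * (ρ - γ) * (Real.exp (-γ * s) * Real.exp (-ρ * (s - t))) +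
        -C / ρ * Real.exp (-ρ * (s - t)))]
  · rw [abs_of_nonneg (by linarith), abs_of_nonpos (by linarith)]
    have e1 : Real.exp (ρ * (0 - t)) = Real.exp (-ρ * (t - 0)) := by congr 1; ring
    have e2 : Real.exp (-ρ * -(t - T)) = Real.exp (-ρ * (T - t)) := by congr 1; ring
    simp only [e1, e2, sub_self, mul_zero, Real.exp_zero]
    rw [hD, hC]
    field_simp
    ring
  · intro s _
    refine HasDerivAt.congr_deriv ((((d0 s).mul (d (-ρ) t s)).const_mul (-k * (ρ - γ))).add
      ((d (-ρ) t s).const_mul (-C/ρ))) ?_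
    rw [hB]; field_simp; ring
  · exact (by fun_prop : Continuous _).intervalIntegrable _ _
  · intro s _
    refine HasDerivAt.congr_deriv ((((d0 s).mul (d ρ t s)).const_mul (k * (ρ + γ))).add
      ((d ρ t s).const_mul (C/ρ))) ?_
    rw [hB]; field_simp; ring
  · exact (by fun_prop : Continuous _).intervalIntegrable _ _

/-- Explicit optimal strategy for an Ornstein–Uhlenbeck expected signal
`h(t) = ι e^{-γt}`, exponential decay kernel `G(t) = κρ e^{-ρt}` and zero risk
aversion: the measure `μ* = A·δ₀ + (B e^{-γt} + C)·1_{[0,T]}(t) dt + D·δ_T`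
belongs to `Ξ(x)`, is the unique minimizer of the cost functional over `Ξ(x)`,
and its inventory is given by the stated explicit formula. -/
theorem stmt_4 (T x ι γ κ ρ : ℝ)
    (hT : 0 < T) (hγ : 0 < γ) (hκ : 0 < κ) (hρ : 0 < ρ)
    (A B C D : ℝ)
    (hB : B = ι * (ρ^2 - γ^2) / (2 * κ * ρ^2 * γ))
    (hA : A = (1 / (2 + T * ρ)) *
      ((ι / (2 * κ * ρ^2 * γ)) *
        ((ρ + γ) * (1 + T * ρ - ((ρ - γ) / γ) * (1 - Real.exp (-γ * T)))
          - (ρ - γ) * Real.exp (-γ * T)) - x))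
    (hC : C = ρ * A - ι * (ρ + γ) / (2 * κ * ρ * γ))
    (hD : D = A - (ι / (2 * κ * ρ^2 * γ)) *
      ((ρ + γ) - (ρ - γ) * Real.exp (-γ * T)))
    (μstar : SignedMeasure ℝ)
    (hμstar : ∀ s : Set ℝ, MeasurableSet s → μstar s =
      s.indicator (fun _ => A) (0:ℝ)
        + (∫ t in s ∩ Set.Icc 0 T, (B * Real.exp (-γ * t) + C))
        + s.indicator (fun _ => D) T)
    (cost : SignedMeasure ℝ → ℝ)
    (hcost : ∀ μ : SignedMeasure ℝ, cost μ =
      sint μ (fun t => ∫ s in (0:ℝ)..t, ι * Real.exp (-γ * s))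
        + (1/2) * sint μ (fun t =>
            sint μ (fun s => κ * ρ * Real.exp (-ρ * |t - s|)))) :
    μstar ∈ Xi T x ∧
    (∀ μ ∈ Xi T x, μ ≠ μstar → cost μstar < cost μ) ∧
    (∀ t : ℝ, 0 < t → t ≤ T →
      x + μstar (Set.Ico 0 t)
        = x + A + (B / γ) * (1 - Real.exp (-γ * t)) + C * t) ∧
    (∀ t : ℝ, T < t → x + μstar (Set.Ico 0 t) = 0) := by
  have hgc : Continuous fun t => B * Real.exp (-γ * t) + C := by fun_prop
  obtain ⟨k, hk⟩ : ∃ k, k = ι / (2 * κ * ρ^2 * γ) := ⟨_, rfl⟩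
  have hB' : B = k * (ρ^2 - γ^2) := by rw [hB, hk]; ring
  have hC' : C = ρ * A - k * ρ * (ρ + γ) := by rw [hC, hk]; field_simp
  have hD' : D = A - k * ((ρ + γ) - (ρ - γ) * Real.exp (-γ * T)) := by rw [hD, hk]
  have hmass : A + ((B / γ) * (1 - Real.exp (-γ * T)) + C * T) + D = -x := by
    rw [← hk] at hA
    have h2 : (2 + T * ρ) ≠ 0 := by positivity
    have hA' : (2 + T * ρ) * A = k * ((ρ + γ) * (1 + T * ρ - ((ρ - γ) / γ) *
        (1 - Real.exp (-γ * T))) - (ρ - γ) * Real.exp (-γ * T)) - x := by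
      rw [hA, ← mul_assoc, mul_one_div_cancel h2, one_mul]
    rw [hD', hC', hB']
    have e : k * (ρ^2 - γ^2) / γ = k * (ρ + γ) * ((ρ - γ) / γ) := by ring
    rw [e]
    linear_combination hA'
  have hsupp : Supp T μstar := by
    intro s hs
    by_cases hm : MeasurableSet s
    · rw [hμstar s hm, hs]
      have h0 : (0:ℝ) ∉ s := fun h => by
        have : (0:ℝ) ∈ s ∩ Set.Icc 0 T := ⟨h, le_rfl, hT.le⟩
        simp [hs] at this
      have h1 : T ∉ s := fun h => by
        have : T ∈ s ∩ Set.Icc 0 T := ⟨h, hT.le, le_rfl⟩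
        simp [hs] at this
      simp [h0, h1]
    · exact μstar.not_measurable hm
  have huniv : μstar Set.univ = -x := by
    rw [hμstar _ MeasurableSet.univ, Set.univ_inter, gint hγ hT.le]
    simpa using hmass
  refine ⟨⟨hsupp, huniv⟩, ?_, ?_, ?_⟩
  · intro μ hμ hne
    obtain ⟨hμs, hμu⟩ := hμ
    have hμs : Supp T μ := hμs
    have hνs := hμs.sub hsupp
    obtain ⟨ν, hν⟩ : ∃ ν, ν = μ - μstar := ⟨_, rfl⟩
    rw [← hν] at hνs
    have hν0 : ν ≠ 0 := by rw [hν]; exact sub_ne_zero.2 hne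
    have hνu : ν Set.univ = 0 := by rw [hν, sub_apply, hμu, huniv, sub_self]
    have := lam_fin hρ T
    have hpos : 0 < ∫ u, sint ν (ph ρ u) * sint ν (ph ρ u) ∂(lam ρ T) := by
      by_contra h
      exact hν0 (posdef hρ hνs (not_lt.1 h))
    -- bounded version of the signal
    let H : ℝ → ℝ := fun t => ι / γ * (1 - Real.exp (-γ * |t|))
    have hH : ∀ t ∈ Set.Icc 0 T, (∫ s in (0:ℝ)..t, ι * Real.exp (-γ * s)) = H t := by
      intro t ht
      have h := gint (B := ι) (C := 0) hγ ht.1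
      rw [integral_Icc_eq_integral_Ioc, ← intervalIntegral.integral_of_le ht.1] at h
      simp only [add_zero, zero_mul] at h
      rw [h]
      simp only [H]
      rw [abs_of_nonneg ht.1]
    have eBM : ∀ a : ℝ, 0 < a → ∀ r : ℝ, BM (fun t => Real.exp (-a * |r - t|)) := by
      intro a ha r
      refine ⟨by fun_prop, 1, fun t => ?_⟩
      rw [Real.norm_eq_abs, Real.abs_exp, Real.exp_le_one_iff]
      nlinarith [abs_nonneg (r - t)]
    have eBM0 : BM (fun t => Real.exp (-γ * |t|)) := by
      simpa using eBM γ hγ 0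
    have HBM : BM H := by
      have := (BM.const (ι / γ)).add ((BM.const (-(ι / γ))).mul eBM0)
      convert this using 2
      simp only [H]; ring
    have hstar : ∀ t ∈ Set.Icc 0 T,
        sint μstar (fun s => κ * ρ * Real.exp (-ρ * |t - s|)) =
          (ι / γ + 2 * κ * C) * 1 + (-1) * H t := by
      intro t ht
      rw [sint_const_mul, star_sint hgc hμstar (eBM ρ hρ t), foc hρ hB' hC' hD' ht]
      simp only [H]
      rw [abs_of_nonneg ht.1, hk]
      field_simp
      ring
    have hcross : sint ν (fun t => sint μstar (fun s => κ * ρ * Real.exp (-ρ * |t - s|))) =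
        - sint ν H := by
      rw [sint_congr hνs hstar, sint_add ν ((BM.const _).mul (BM.const _)) ((BM.const _).mul HBM),
        sint_const_mul, sint_const_mul, sint_one, hνu]
      ring
    rw [quad hρ hνs hsupp] at hcross
    rw [hcost, hcost, quad hρ hμs hμs, quad hρ hsupp hsupp, sint_congr hμs hH,
      sint_congr hsupp hH]
    have hHs : sint ν H = sint μ H - sint μstar H := by rw [hν, sint_sub _ _ HBM]
    have b1 := sint_meas ν (ph_meas ρ) (ph_bd hρ)
    have b2 := sint_meas μstar (ph_meas ρ) (ph_bd hρ)
    have hexp : ∫ u, sint μ (ph ρ u) * sint μ (ph ρ u) ∂(lam ρ T) =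
        (∫ u, sint μstar (ph ρ u) * sint μstar (ph ρ u) ∂(lam ρ T)) +
        2 * (∫ u, sint ν (ph ρ u) * sint μstar (ph ρ u) ∂(lam ρ T)) +
        ∫ u, sint ν (ph ρ u) * sint ν (ph ρ u) ∂(lam ρ T) := by
      rw [← integral_const_mul, ← integral_add ((b2.mul b2).integrable _)
        (((b1.mul b2).integrable _).const_mul _), ← integral_add
          (((b2.mul b2).add ((BM.const 2).mul (b1.mul b2))).integrable _)
          ((b1.mul b1).integrable _)]
      refine integral_congr_ae (Filter.Eventually.of_forall fun u => ?_)
      have : sint ν (ph ρ u) = sint μ (ph ρ u) - sint μstar (ph ρ u) := by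
        rw [hν, sint_sub _ _ (ph_BM hρ u)]
      simp only [this]
      ring
    rw [hexp]
    have hfin : 0 < κ * ρ * ∫ u, sint ν (ph ρ u) * sint ν (ph ρ u) ∂(lam ρ T) := by positivity
    linarith
  · intro t h0 h1
    rw [hμstar _ measurableSet_Ico]
    have e1 : ∫ s in Set.Ico 0 t ∩ Set.Icc 0 T, (B * Real.exp (-γ * s) + C) =
        ∫ s in Set.Icc 0 t, (B * Real.exp (-γ * s) + C) := by
      have : Set.Ico 0 t ∩ Set.Icc 0 T = Set.Ico 0 t := by
        ext s; simp only [Set.mem_inter_iff, Set.mem_Ico, Set.mem_Icc]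
        constructor
        · exact fun h => h.1
        · exact fun h => ⟨h, h.1, by linarith [h.2]⟩
      rw [this, integral_Ico_eq_integral_Ioo, integral_Icc_eq_integral_Ioo]
    rw [e1, gint hγ h0.le]
    have m1 : (0:ℝ) ∈ Set.Ico 0 t := ⟨le_rfl, h0⟩
    have m2 : T ∉ Set.Ico 0 t := fun h => absurd h.2 (not_lt.2 h1)
    rw [Set.indicator_of_mem m1, Set.indicator_of_notMem m2]
    ring
  · intro t ht
    rw [hμstar _ measurableSet_Ico]
    have : Set.Ico 0 t ∩ Set.Icc 0 T = Set.Icc 0 T := by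
      ext s; simp only [Set.mem_inter_iff, Set.mem_Ico, Set.mem_Icc]
      constructor
      · exact fun h => h.2
      · exact fun h => ⟨⟨h.1, by linarith [h.2]⟩, h⟩
    have m1 : (0:ℝ) ∈ Set.Ico 0 t := ⟨le_rfl, hT.trans ht⟩
    have m2 : T ∈ Set.Ico 0 t := ⟨hT.le, ht⟩
    rw [this, gint hγ hT.le, Set.indicator_of_mem m1, Set.indicator_of_mem m2, hmass]
    ring
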